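/- Let L = sl(3|2), with even part L₀̄ and odd part L₁̄, and let L₀ denote L₀̄ regarded as an ordinary Lie algebra under the commutator. Form the super-exterior square Λε²L := ⋀²(L₀̄) ⊕ (L₀̄ ⊗ L₁̄) ⊕ Sym²(L₁̄), with L₀ acting on each summand through the adjoint action C·x = ⟨C,x⟩ on each tensor factor (derivation action on ⋀² and Sym²). Then Λε²L is the direct sum of 27 irreducible L₀-submodules, where an L₀-submodule is irreducible if it is nonzero and has no L₀-invariant subspace other than {0} and itself. -/

import Mathlib

open Matrix

variable (K : Type) [Field K]

/-- The space of matrices underlying `gl(m|n)`. -/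
abbrev gl (m n : ℕ) : Type := Matrix (Fin (m + n)) (Fin (m + n)) K

/-- The parity of an index: indices `< m` are even, the rest odd. -/
def par (m n : ℕ) (i : Fin (m + n)) : ZMod 2 := if (i : ℕ) < m then 0 else 1

/-- `A` is homogeneous of parity `p`. -/
def IsHom {m n : ℕ} (p : ZMod 2) (A : gl K m n) : Prop :=
  ∀ i j, A i j ≠ 0 → par m n i + par m n j = p

/-- The sign `(-1)^p` for `p : ZMod 2`. -/
def sg (p : ZMod 2) : K := if p = 0 then 1 else -1

/-- The even (block-diagonal) part of a matrix. -/
def evenP {m n : ℕ} (A : gl K m n) : gl K m n :=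
  Matrix.of fun i j => if par m n i = par m n j then A i j else 0

/-- The odd (block-off-diagonal) part of a matrix. -/
def oddP {m n : ℕ} (A : gl K m n) : gl K m n :=
  Matrix.of fun i j => if par m n i = par m n j then 0 else A i j

/-- The super bracket `⟨A,B⟩ = AB - (-1)^{|A||B|} BA` on homogeneous elements,
extended bilinearly to all of `gl(m|n)`. -/
def sbr {m n : ℕ} (A B : gl K m n) : gl K m n :=
  A * B - evenP K B * A - oddP K B * evenP K A + oddP K B * oddP K A

/-- The supertrace `Str(A) = Tr(a) - Tr(d)`. -/
def str {m n : ℕ} (A : gl K m n) : K := ∑ i, sg K (par m n i) * A i i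

/-- `sl(m|n)`, the subspace of supertraceless matrices, as a submodule of `gl(m|n)`. -/
def sl (m n : ℕ) : Submodule K (gl K m n) where
  carrier := {A | str K A = 0}
  add_mem' {A B} hA hB := by
    simp only [Set.mem_setOf_eq, str] at *
    simp [Matrix.add_apply, mul_add, Finset.sum_add_distrib, hA, hB]
  zero_mem' := by simp [str]
  smul_mem' c A hA := by
    simp only [Set.mem_setOf_eq, str] at *
    simp only [Matrix.smul_apply, smul_eq_mul, mul_left_comm, ← Finset.mul_sum, hA, mul_zero]

/-- The even projection as a linear map. -/
def evenPL (m n : ℕ) : gl K m n →ₗ[K] gl K m n where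
  toFun := evenP K
  map_add' A B := by ext i j; simp only [evenP, Matrix.add_apply, Matrix.of_apply]; split <;> simp
  map_smul' c A := by
    ext i j; simp only [evenP, Matrix.smul_apply, Matrix.of_apply, RingHom.id_apply]
    split <;> simp

/-- The odd projection as a linear map. -/
def oddPL (m n : ℕ) : gl K m n →ₗ[K] gl K m n where
  toFun := oddP K
  map_add' A B := by ext i j; simp only [oddP, Matrix.add_apply, Matrix.of_apply]; split <;> simp
  map_smul' c A := by
    ext i j; simp only [oddP, Matrix.smul_apply, Matrix.of_apply, RingHom.id_apply]
    split <;> simp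

/-- The super bracket `x ↦ ⟨a,x⟩` as a linear map. -/
def lsbr {m n : ℕ} (a : gl K m n) : gl K m n →ₗ[K] gl K m n :=
  LinearMap.mulLeft K a - (LinearMap.mulRight K a) ∘ₗ evenPL K m n
    - (LinearMap.mulRight K (evenP K a)) ∘ₗ oddPL K m n
    + (LinearMap.mulRight K (oddP K a)) ∘ₗ oddPL K m n

/-- The action `C·(x⊗y) = ⟨C,x⟩⊗y + x⊗⟨C,y⟩` of an even element `C` on 2-tensors
(derivation action on `⋀²` and `Sym²`). -/
noncomputable def actC (C : gl K 3 2) :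
    TensorProduct K (gl K 3 2) (gl K 3 2) →ₗ[K] TensorProduct K (gl K 3 2) (gl K 3 2) :=
  TensorProduct.map (lsbr K C) LinearMap.id + TensorProduct.map LinearMap.id (lsbr K C)

/-- The super-exterior square `Λε²L = ⋀²(L₀̄) ⊕ (L₀̄ ⊗ L₁̄) ⊕ Sym²(L₁̄)` of `L = sl(3|2)`,
realized inside `L ⊗ L` as the span of the elements `x⊗y - (-1)^{|x||y|} y⊗x` for
homogeneous `x, y ∈ L`. -/
def superExtSq : Submodule K (TensorProduct K (gl K 3 2) (gl K 3 2)) :=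
  Submodule.span K {t | ∃ (q1 q2 : ZMod 2) (x y : ↥(sl K 3 2)),
    IsHom K q1 (x : gl K 3 2) ∧ IsHom K q2 (y : gl K 3 2) ∧
    t = (x : gl K 3 2) ⊗ₜ[K] (y : gl K 3 2)
      - sg K (q1 * q2) • ((y : gl K 3 2) ⊗ₜ[K] (x : gl K 3 2))}

namespace SuperExt

/-- Indices `(i, j, k, l)` of the basis tensors `E i j ⊗ E k l` of `gl(3|2) ⊗ gl(3|2)`. -/
abbrev Idx := Fin (3 + 2) × Fin (3 + 2) × Fin (3 + 2) × Fin (3 + 2)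

/-- A 2-tensor with integer coefficients, as a list of terms. -/
abbrev Sparse := List (Idx × ℤ)

/-- The coefficient of a basis tensor in a sparse tensor. -/
def coef (p : Idx) : Sparse → ℤ
  | [] => 0
  | t :: l => (if t.1 = p then t.2 else 0) + coef p l

/-- Scalar multiplication of sparse tensors. -/
def scale (c : ℤ) (l : Sparse) : Sparse := l.map fun t => (t.1, c * t.2)

/-- Whether all coefficients of a sparse tensor vanish. -/
def isZero (l : Sparse) : Bool := l.all fun t => coef t.1 l == 0

/-- The standard inner product of sparse tensors. -/
def dot (l l' : Sparse) : ℤ := (l.map fun t => t.2 * coef t.1 l').sum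

/-- The commutator action of the matrix unit `E a b` on a basis tensor. -/
def unitAct (a b : Fin (3 + 2)) (p : Idx) : Sparse :=
  (if p.1 = b then [((a, p.2), 1)] else []) ++
  (if p.2.1 = a then [((p.1, b, p.2.2), -1)] else []) ++
  (if p.2.2.1 = b then [((p.1, p.2.1, a, p.2.2.2), 1)] else []) ++
  (if p.2.2.2 = a then [((p.1, p.2.1, p.2.2.1, b), -1)] else [])

/-- The commutator action of the matrix unit `E a b` on a sparse tensor. -/
def sparseAct (a b : Fin (3 + 2)) (l : Sparse) : Sparse :=
  l.flatMap fun t => scale t.2 (unitAct a b t.1)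

/-- An integer matrix, as a list of entries. -/
abbrev SparseMat := List ((Fin (3 + 2) × Fin (3 + 2)) × ℤ)

/-- The tensor product of two sparse matrices. -/
def outer (X Y : SparseMat) : Sparse :=
  X.flatMap fun x => Y.map fun y => ((x.1.1, x.1.2, y.1.1, y.1.2), x.2 * y.2)

/-- Whether the matrix unit `E i j` is odd. -/
def odd (i j : Fin (3 + 2)) : Bool := (i.val < 3) != (j.val < 3)

/-- Two matrices `X`, `Y` with their parities, standing for the tensor
`X ⊗ Y - (-1) ^ (|X| |Y|) Y ⊗ X`. -/
structure Gen where
  p : Bool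
  q : Bool
  X : SparseMat
  Y : SparseMat

/-- The sign `(-1) ^ b`. -/
def zsign (b : Bool) : ℤ := if b then -1 else 1

/-- The tensor `X ⊗ Y - (-1) ^ (|X| |Y|) Y ⊗ X`. -/
def Gen.sparse (g : Gen) : Sparse :=
  outer g.X g.Y ++ scale (-zsign (g.p && g.q)) (outer g.Y g.X)

/-- The matrix unit `E i j`. -/
def e (i j : Fin (3 + 2)) : SparseMat := [((i, j), 1)]

/-- A diagonal matrix. -/
def d (x : Fin (3 + 2) → ℤ) : SparseMat := (List.finRange (3 + 2)).map fun i => ((i, i), x i)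

/-- The central element of the even part of `sl(3|2)`. -/
def z : SparseMat := d ![2, 2, 2, 3, 3]

/-- A generator with both factors even. -/
def ee (X Y : SparseMat) : Gen := ⟨false, false, X, Y⟩

/-- A generator with an even and an odd factor. -/
def eo (X Y : SparseMat) : Gen := ⟨false, true, X, Y⟩

/-- A generator with both factors odd. -/
def oo (X Y : SparseMat) : Gen := ⟨true, true, X, Y⟩

/-- Negation of a sparse matrix. -/
def neg (X : SparseMat) : SparseMat := X.map fun t => (t.1, -t.2)

/-- Generators whose sums are highest weight vectors of the 27 components. -/
def highest : Fin 27 → List Gen := ![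
  [ee (e 0 2) (e 0 1)],
  [ee (e 0 2) (e 1 2)],
  [ee (e 0 1) (e 1 2), ee (e 0 2) (d ![-1, 0, 1, 0, 0])],
  [ee (e 0 2) z],
  [ee (e 0 2) (e 3 4)],
  [ee (e 3 4) (d ![0, 0, 0, 1, -1])],
  [ee (e 3 4) z],
  [eo (e 0 2) (e 0 4)],
  [eo (e 0 2) (e 1 4), eo (neg (e 1 2)) (e 0 4)],
  [eo [((0, 1), 3)] (e 1 4), eo [((0, 2), 3)] (e 2 4), eo (d ![2, -1, -1, 0, 0]) (e 0 4)],
  [eo (e 3 4) (e 0 4)],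
  [eo [((3, 4), 2)] (e 0 3), eo (d ![0, 0, 0, -1, 1]) (e 0 4)],
  [eo z (e 0 4)],
  [eo (e 0 2) (e 3 2)],
  [eo (e 0 2) (e 3 1), eo (neg (e 0 1)) (e 3 2)],
  [eo [((1, 2), 3)] (e 3 1), eo [((0, 2), 3)] (e 3 0), eo (d ![-1, -1, 2, 0, 0]) (e 3 2)],
  [eo (e 3 4) (e 3 2)],
  [eo [((3, 4), 2)] (e 4 2), eo (d ![0, 0, 0, 1, -1]) (e 3 2)],
  [eo z (e 3 2)],
  [oo (e 0 4) (e 0 4)],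
  [oo (e 0 4) (e 1 3), oo (neg (e 0 3)) (e 1 4)],
  [oo (e 3 2) (e 3 2)],
  [oo (e 3 2) (e 4 1), oo (neg (e 3 1)) (e 4 2)],
  [oo (e 0 4) (e 3 2)],
  [oo (e 0 3) (e 3 2), oo (e 0 4) (e 4 2)],
  [oo (e 0 4) (e 3 0), oo (e 1 4) (e 3 1), oo (e 2 4) (e 3 2)],
  [oo (e 0 3) (e 3 0), oo (e 1 3) (e 3 1), oo (e 2 3) (e 3 2),
   oo (e 0 4) (e 4 0), oo (e 1 4) (e 4 1), oo (e 2 4) (e 4 2)]]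

/-- The `i`-th highest weight vector. -/
def hw (i : Fin 27) : Sparse := (highest i).flatMap Gen.sparse

/-- The supertrace of a sparse matrix. -/
def strL (X : SparseMat) : ℤ :=
  (X.map fun t => if t.1.1 = t.1.2 then zsign (odd 0 t.1.1) * t.2 else 0).sum

/-- Whether a sparse matrix is homogeneous of the given parity. -/
def homL (p : Bool) (X : SparseMat) : Bool :=
  X.all fun t => odd t.1.1 t.1.2 == p

/-- Whether both matrices are supertraceless and of the declared parity. -/
def Gen.valid (g : Gen) : Bool :=
  strL g.X == 0 && strL g.Y == 0 && homL g.p g.X && homL g.q g.Y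

/-- The eigenvalue of `E a a` on a basis tensor. -/
def wtF (p : Idx) (a : Fin (3 + 2)) : ℤ :=
  (if a = p.1 then 1 else 0) - (if a = p.2.1 then 1 else 0) +
    (if a = p.2.2.1 then 1 else 0) - (if a = p.2.2.2 then 1 else 0)

/-- The eigenvalue of `E a a` on a weight vector, read off from its first term. -/
def wtL (l : Sparse) (a : Fin (3 + 2)) : ℤ :=
  match l with
  | [] => 0
  | t :: _ => wtF t.1 a

/-- Eliminate the first column from all rows, with pivot row `a :: r`. -/
def reduceRows (a : ℤ) (r : List ℤ) : List (List ℤ) → List (List ℤ)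
  | [] => []
  | [] :: l => reduceRows a r l
  | (b :: s) :: l =>
    (if b = 0 then s else List.zipWith (fun y x => a * y - b * x) s r) :: reduceRows a r l

/-- A row with nonzero first entry. -/
def findPivot : List (List ℤ) → Option (ℤ × List ℤ)
  | [] => none
  | [] :: l => findPivot l
  | (a :: r) :: l => if a = 0 then findPivot l else some (a, r)

/-- Fraction-free Gaussian elimination: whether the rows have rank `n`. -/
def nonsing : ℕ → List (List ℤ) → Bool
  | 0, _ => true
  | n + 1, rows =>
    match findPivot rows with
    | none => false
    | some (a, r) => nonsing n (reduceRows a r rows)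

/-- An integer encoding of the torus weight of a basis tensor. -/
def weight (p : Idx) : ℕ :=
  6 ^ p.1.val + 6 ^ p.2.2.1.val + 6 ^ 5 - 6 ^ p.2.1.val - 6 ^ p.2.2.2.val

/-- All indices of basis tensors. -/
def allIdx : List Idx :=
  List.finRange (3 + 2) ×ˢ (List.finRange (3 + 2) ×ˢ
    (List.finRange (3 + 2) ×ˢ List.finRange (3 + 2)))

/-- The functional expressing super-antisymmetry at a given index. -/
def swapRow (p : Idx) : Sparse :=
  [(p, 1), ((p.2.2.1, p.2.2.2, p.1, p.2.1), zsign (odd p.1 p.2.1 && odd p.2.2.1 p.2.2.2))]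

/-- The functional expressing that the first tensor factor is supertraceless. -/
def strRow (k l : Fin (3 + 2)) : Sparse :=
  (List.finRange (3 + 2)).map fun i => ((i, i, k, l), zsign (odd 0 i))

/-- The coordinates of `E a b • x`, as functionals of the coordinates of `x` in `vars`. -/
def singRows (a b : Fin (3 + 2)) (vars : List Idx) : List Sparse :=
  ((vars.flatMap fun p => (unitAct a b p).map Prod.fst).dedup).map (unitAct b a)

/-- Whether the first term of a sparse tensor has weight `w`. -/
def hasWeight (w : ℕ) (l : Sparse) : Bool :=
  match l with
  | [] => false
  | t :: _ => weight t.1 == w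

/-- The indices of weight `w`. -/
def block (w : ℕ) : List Idx := allIdx.filter fun p => weight p == w

/-- The equations of weight `w` satisfied by a singular vector of the super-exterior square that is
orthogonal to all the highest weight vectors. -/
def blockRows (w : ℕ) (vars : List Idx) : List Sparse :=
  vars.map swapRow ++
  ((vars.filter fun p => p.1 = 0 ∧ p.2.1 = 0).map fun p => strRow p.2.2.1 p.2.2.2) ++
  singRows 0 1 vars ++ singRows 1 2 vars ++ singRows 3 4 vars ++
  ((List.finRange 27).map hw).filter (hasWeight w)

/-- Whether `blockRows w vars` involve only `vars` and determine the zero solution. -/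
def blockCheck (w : ℕ) (vars : List Idx) : Bool :=
  let rows := blockRows w vars
  (rows.all fun r => r.all fun t => vars.contains t.1) &&
  nonsing vars.length (rows.map fun r => vars.map fun p => coef p r)

/-- Insert a number into a list unless it is there already. -/
def insertNat (n : ℕ) (l : List ℕ) : List ℕ := if l.contains n then l else n :: l

/-- The weights of all basis tensors. -/
def weights : List ℕ := allIdx.foldr (fun p l => insertNat (weight p) l) []

theorem dot_reduceRows {R : Type*} [CommRing R] (a : ℤ) (r : List ℤ) (x : R) (xs : List R)
    (hr : (a : R) * x + (List.zipWith (fun (c : ℤ) y => (c : R) * y) r xs).sum = 0)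
    (rows : List (List ℤ)) (hlen : r.length = xs.length)
    (hl : ∀ s ∈ rows, s.length = xs.length + 1)
    (h : ∀ s ∈ rows, (List.zipWith (fun (c : ℤ) y => (c : R) * y) s (x :: xs)).sum = 0) :
    ∀ s ∈ reduceRows a r rows, s.length = xs.length ∧
      (List.zipWith (fun (c : ℤ) y => (c : R) * y) s xs).sum = 0 := by
  have comb : ∀ (b : ℤ) (s r : List ℤ) (xs : List R), s.length = xs.length → r.length = xs.length →
      (List.zipWith (fun (c : ℤ) y => (c : R) * y)
        (List.zipWith (fun y x => a * y - b * x) s r) xs).sum =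
      a * (List.zipWith (fun (c : ℤ) y => (c : R) * y) s xs).sum -
      b * (List.zipWith (fun (c : ℤ) y => (c : R) * y) r xs).sum := by
    intro b s
    induction s with
    | nil => intro r xs h1 h2; cases xs <;> simp_all
    | cons c s ih =>
      intro r xs h1 h2
      cases xs with
      | nil => simp at h1
      | cons y xs =>
        cases r with
        | nil => simp at h2
        | cons e r =>
          simp only [List.zipWith_cons_cons, List.sum_cons]
          rw [ih r xs (by simpa using h1) (by simpa using h2)]
          push_cast; ring
  induction rows with
  | nil => simp [reduceRows]
  | cons t rows ih =>
    have ih := ih (fun s hs => hl s (by simp [hs])) (fun s hs => h s (by simp [hs]))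
    have h1 := hl t (by simp)
    have h2 := h t (by simp)
    cases t with
    | nil => simp at h1
    | cons b t =>
      simp only [List.zipWith_cons_cons, List.sum_cons] at h2
      simp only [List.length_cons, add_left_inj] at h1
      intro s hs
      simp only [reduceRows, List.mem_cons] at hs
      rcases hs with rfl | hs
      · split_ifs with hb
        · exact ⟨h1, by simpa [hb] using h2⟩
        · refine ⟨by simp [h1, hlen], ?_⟩
          rw [comb b t r xs h1 hlen]
          linear_combination (a : R) * h2 - b * hr
      · exact ih s hs

theorem findPivot_spec (rows : List (List ℤ)) (a : ℤ) (r : List ℤ)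
    (h : findPivot rows = some (a, r)) : a ≠ 0 ∧ (a :: r) ∈ rows := by
  induction rows with
  | nil => simp [findPivot] at h
  | cons t rows ih =>
    cases t with
    | nil => simp only [findPivot] at h; have := ih h; simp [this]
    | cons b t =>
      simp only [findPivot] at h
      split_ifs at h with hb
      · have := ih h; simp [this]
      · simp only [Option.some.injEq, Prod.mk.injEq] at h
        obtain ⟨rfl, rfl⟩ := h
        simp [hb]

theorem eq_zero_of_nonsing {R : Type*} [CommRing R] [IsDomain R] [CharZero R] (xs : List R)
    (rows : List (List ℤ)) (hn : nonsing xs.length rows = true)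
    (hl : ∀ s ∈ rows, s.length = xs.length)
    (h : ∀ s ∈ rows, (List.zipWith (fun (c : ℤ) y => (c : R) * y) s xs).sum = 0) :
    ∀ x ∈ xs, x = 0 := by
  induction xs generalizing rows with
  | nil => simp
  | cons x xs ih =>
    simp only [List.length_cons, nonsing] at hn
    split at hn
    · simp at hn
    · rename_i a r hp
      obtain ⟨ha, hr⟩ := findPivot_spec _ _ _ hp
      have h1 := hl _ hr
      have h2 := h _ hr
      simp only [List.zipWith_cons_cons, List.sum_cons] at h2
      simp only [List.length_cons, add_left_inj] at h1
      have key := dot_reduceRows a r x xs h2 rows h1 (by simpa using hl) h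
      have hx := ih _ hn (fun s hs => (key s hs).1) (fun s hs => (key s hs).2)
      have hz : (List.zipWith (fun (c : ℤ) y => (c : R) * y) r xs).sum = 0 := by
        apply List.sum_eq_zero
        intro y hy
        rw [List.mem_iff_getElem] at hy
        obtain ⟨i, hi, rfl⟩ := hy
        rw [List.getElem_zipWith, hx _ (List.getElem_mem _), mul_zero]
      rw [hz, add_zero] at h2
      have : x = 0 := by
        rcases mul_eq_zero.mp h2 with h2 | h2
        · exact absurd (by exact_mod_cast h2) ha
        · exact h2
      intro y hy
      rcases List.mem_cons.mp hy with rfl | hy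
      · exact this
      · exact hx y hy

/-- The value of a sparse functional on an assignment of the coordinates. -/
def ev {R : Type*} [Ring R] (f : Idx → R) (l : Sparse) : R := (l.map fun t => (t.2 : R) * f t.1).sum

theorem ev_eq_sum_coef {R : Type*} [CommRing R] (f : Idx → R) (vars : List Idx) (hv : vars.Nodup)
    (l : Sparse) (hl : ∀ t ∈ l, t.1 ∈ vars) :
    ev f l = (vars.map fun p => (coef p l : R) * f p).sum := by
  rw [ev]
  induction l with
  | nil => simp [coef]
  | cons t l ih =>
    rw [List.map_cons, List.sum_cons, ih fun s hs => hl s (by simp [hs])]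
    simp only [coef, Int.cast_add, add_mul, List.sum_map_add]
    congr 1
    rw [← List.sum_toFinset _ hv, Finset.sum_eq_single t.1]
    · simp
    · intro b _ hb; simp [hb.symm]
    · intro h; exact absurd (by simpa using hl t (by simp)) h

theorem eq_zero_of_blockCheck {R : Type*} [CommRing R] [IsDomain R] [CharZero R] (f : Idx → R)
    (w : ℕ) (vars : List Idx) (hv : vars.Nodup) (hc : blockCheck w vars = true)
    (h : ∀ r ∈ blockRows w vars, ev f r = 0) : ∀ p ∈ vars, f p = 0 := by
  simp only [blockCheck, Bool.and_eq_true, List.all_eq_true, List.contains_iff_mem] at hc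
  have := eq_zero_of_nonsing (vars.map f) _ (by simpa using hc.2) (by simp) (by
    intro s hs
    obtain ⟨r, hr, rfl⟩ := List.mem_map.mp hs
    rw [← h r hr, ev_eq_sum_coef f vars hv r (hc.1 r hr)]
    congr 1
    simp [List.zipWith_map])
  intro p hp
  exact this _ (List.mem_map_of_mem hp)

theorem blockCheck_weights : (weights.all fun w => blockCheck w (block w)) = true := by decide +kernel

theorem mem_allIdx (p : Idx) : p ∈ allIdx := by
  obtain ⟨i, j, k, l⟩ := p
  iterate 3 refine List.mem_product.mpr ⟨List.mem_finRange _, ?_⟩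
  exact List.mem_finRange _

theorem nodup_allIdx : allIdx.Nodup :=
  have h := List.nodup_finRange (3 + 2)
  h.product (h.product (h.product h))

theorem mem_insertNat (n m : ℕ) (l : List ℕ) : m ∈ insertNat n l ↔ m = n ∨ m ∈ l := by
  rw [insertNat]
  split_ifs with h
  · rw [List.contains_iff_mem] at h
    exact ⟨Or.inr, by rintro (rfl | h') <;> assumption⟩
  · simp

theorem weight_mem_weights (p : Idx) : weight p ∈ weights := by
  have : ∀ l : List Idx, p ∈ l → weight p ∈ l.foldr (fun p l => insertNat (weight p) l) [] := by
    intro l hl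
    induction l with
    | nil => simp at hl
    | cons q l ih =>
      rw [List.foldr_cons, mem_insertNat]
      rcases List.mem_cons.mp hl with rfl | h
      · exact Or.inl rfl
      · exact Or.inr (ih h)
  exact this _ (mem_allIdx p)

theorem eq_zero_of_rows {R : Type*} [CommRing R] [IsDomain R] [CharZero R] (f : Idx → R)
    (hswap : ∀ p, ev f (swapRow p) = 0) (hstr : ∀ k l, ev f (strRow k l) = 0)
    (hraise : ∀ a b p, a < b → odd a b = false → ev f (unitAct b a p) = 0)
    (horth : ∀ i, ev f (hw i) = 0) (p : Idx) : f p = 0 := by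
  have hc := List.all_eq_true.mp blockCheck_weights _ (weight_mem_weights p)
  refine eq_zero_of_blockCheck f _ _ (nodup_allIdx.filter _) hc ?_ p
    (by simp [mem_allIdx])
  intro r hr
  simp only [blockRows, singRows, List.mem_append, List.mem_map, List.mem_filter] at hr
  rcases hr with ((((⟨q, -, rfl⟩ | ⟨q, -, rfl⟩) | ⟨q, -, rfl⟩) | ⟨q, -, rfl⟩) | ⟨q, -, rfl⟩) |
    ⟨⟨i, -, rfl⟩, -⟩
  · exact hswap q
  · exact hstr _ _
  · exact hraise 0 1 q (by decide) (by decide)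
  · exact hraise 1 2 q (by decide) (by decide)
  · exact hraise 3 4 q (by decide) (by decide)
  · exact horth i

section Algebra
open TensorProduct
attribute [local instance] LieRing.ofAssociativeRing

/-- The ambient tensor square. -/
abbrev Sq : Type := gl K 3 2 ⊗[K] gl K 3 2

/-- The basis tensor `E i j ⊗ E k l`. -/
noncomputable def tens (p : Idx) : Sq K :=
  (single p.1 p.2.1 1 : gl K 3 2) ⊗ₜ[K] (single p.2.2.1 p.2.2.2 1 : gl K 3 2)

/-- The tensor with the given list of terms. -/
noncomputable def vec (l : Sparse) : Sq K := (l.map fun t => (t.2 : K) • tens K t.1).sum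

/-- The bilinear form `Tr(Aᵀ D)`. -/
def frob : LinearMap.BilinForm K (gl K 3 2) :=
  LinearMap.mk₂ K (fun A D => trace (Aᵀ * D)) (by intros; simp [add_mul]) (by intros; simp)
    (by intros; simp [mul_add]) (by intros; simp)

/-- The bilinear form on the tensor square for which the basis tensors are orthonormal. -/
noncomputable def form : LinearMap.BilinForm K (Sq K) := (frob K).tmul (frob K)

variable {K}

theorem frob_apply (A D : gl K 3 2) : frob K A D = trace (Aᵀ * D) := rfl

theorem form_tmul (A A' D D' : gl K 3 2) :
    form K (A ⊗ₜ A') (D ⊗ₜ D') = frob K A D * frob K A' D' := by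
  simp [form, LinearMap.BilinForm.tmul, mul_comm]

theorem frob_single (i j : Fin (3 + 2)) (A : gl K 3 2) : frob K (single i j 1) A = A i j := by
  rw [frob_apply, transpose_single, trace_single_mul]; simp

theorem frob_comm (A D : gl K 3 2) : frob K A D = frob K D A := by
  rw [frob_apply, frob_apply, ← trace_transpose, transpose_mul, transpose_transpose]

theorem frob_lie (C A D : gl K 3 2) : frob K ⁅C, A⁆ D = frob K A ⁅Cᵀ, D⁆ := by
  simp only [frob_apply, Ring.lie_def, transpose_sub, transpose_mul, sub_mul, mul_sub, trace_sub,
    Matrix.mul_assoc]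
  rw [trace_mul_comm Cᵀ (Aᵀ * D), Matrix.mul_assoc]

theorem form_comm (x y : Sq K) : form K x y = form K y x := by
  induction x using TensorProduct.induction_on with
  | zero => simp
  | add x x' h h' => simp [h, h']
  | tmul A A' =>
    induction y using TensorProduct.induction_on with
    | zero => simp
    | add x x' h h' => simp [h, h']
    | tmul D D' => rw [form_tmul, form_tmul, frob_comm A, frob_comm A']

theorem form_lie (C : gl K 3 2) (x y : Sq K) : form K ⁅C, x⁆ y = form K x ⁅Cᵀ, y⁆ := by
  induction x using TensorProduct.induction_on with
  | zero => simp
  | add x x' h h' => simp [h, h']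
  | tmul A A' =>
    induction y using TensorProduct.induction_on with
    | zero => simp
    | add x x' h h' => simp only [map_add, lie_add, h, h']
    | tmul D D' =>
      simp only [TensorProduct.LieModule.lie_tmul_right, map_add, LinearMap.add_apply, form_tmul,
        frob_lie]

theorem form_tens_tmul (p : Idx) (A D : gl K 3 2) :
    form K (tens K p) (A ⊗ₜ D) = A p.1 p.2.1 * D p.2.2.1 p.2.2.2 := by
  rw [tens, form_tmul, frob_single, frob_single]

theorem form_tens_tens (p q : Idx) : form K (tens K p) (tens K q) = if q = p then 1 else 0 := by
  rw [tens.eq_def K q, form_tens_tmul]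
  obtain ⟨i, j, k, l⟩ := p
  obtain ⟨i', j', k', l'⟩ := q
  simp only [single_apply, Prod.mk.injEq, mul_ite, mul_one, mul_zero, ← ite_and]
  congr 1
  simp only [eq_iff_iff]; tauto

theorem sum_form_smul_tens (x : Sq K) : ∑ p, form K (tens K p) x • tens K p = x := by
  induction x using TensorProduct.induction_on with
  | zero => simp
  | add x y hx hy => simp only [map_add, add_smul, Finset.sum_add_distrib, hx, hy]
  | tmul A D =>
    conv_rhs => rw [matrix_eq_sum_single A, matrix_eq_sum_single D]
    simp_rw [form_tens_tmul, Fintype.sum_prod_type, sum_tmul, tmul_sum]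
    refine Finset.sum_congr rfl fun i _ => Finset.sum_congr rfl fun j _ =>
      Finset.sum_congr rfl fun k _ => Finset.sum_congr rfl fun l _ => ?_
    rw [tens, ← smul_tmul_smul, smul_single, smul_single]; simp

theorem eq_zero_of_form_tens (x : Sq K) (h : ∀ p, form K (tens K p) x = 0) : x = 0 := by
  rw [← sum_form_smul_tens x]; simp [h]

@[simp] theorem vec_nil : vec K [] = 0 := rfl

@[simp] theorem vec_cons (t : Idx × ℤ) (l : Sparse) :
    vec K (t :: l) = (t.2 : K) • tens K t.1 + vec K l := rfl

@[simp] theorem vec_append (l l' : Sparse) : vec K (l ++ l') = vec K l + vec K l' := by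
  simp [vec]

@[simp] theorem vec_scale (c : ℤ) (l : Sparse) : vec K (scale c l) = (c : K) • vec K l := by
  induction l with
  | nil => simp [scale]
  | cons t l ih =>
    rw [vec_cons, smul_add, ← ih, smul_smul, ← Int.cast_mul]; rfl

theorem form_vec (l : Sparse) (x : Sq K) :
    form K (vec K l) x = ev (fun p => form K (tens K p) x) l := by
  induction l with
  | nil => simp [ev]
  | cons t l ih =>
    rw [vec_cons, map_add, LinearMap.add_apply, ih]
    simp [ev]

theorem form_tens_vec (p : Idx) (l : Sparse) : form K (tens K p) (vec K l) = coef p l := by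
  induction l with
  | nil => simp [coef]
  | cons t l ih => simp [ih, coef, form_tens_tens]

theorem form_vec_vec (l l' : Sparse) : form K (vec K l) (vec K l') = dot l l' := by
  rw [form_vec, ev, dot, Int.cast_list_sum, List.map_map]
  simp [form_tens_vec, Function.comp_def]

theorem coef_eq_zero (p : Idx) (l : Sparse) (h : ∀ t ∈ l, t.1 ≠ p) : coef p l = 0 := by
  induction l with
  | nil => rfl
  | cons t l ih => simp only [List.mem_cons, forall_eq_or_imp] at h; simp [coef, h.1, ih h.2]

theorem vec_eq_zero (l : Sparse) (h : isZero l = true) : vec K l = 0 := by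
  refine eq_zero_of_form_tens _ fun p => ?_
  rw [form_tens_vec]
  by_cases hp : ∃ t ∈ l, t.1 = p
  · obtain ⟨t, ht, rfl⟩ := hp
    simp only [isZero, List.all_eq_true, beq_iff_eq] at h
    simp [h t ht]
  · push Not at hp
    simp [coef_eq_zero p l hp]

theorem neg_one_smul' (x : Sq K) : (-1 : K) • x = -x := neg_one_smul K x

theorem lie_smul' (C : gl K 3 2) (c : K) (x : Sq K) : ⁅C, c • x⁆ = c • ⁅C, x⁆ := lie_smul c C x

theorem lie_single (a b i j : Fin (3 + 2)) :
    ⁅(single a b 1 : gl K 3 2), (single i j 1 : gl K 3 2)⁆ =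
      (if i = b then single a j 1 else 0) - if j = a then single i b 1 else 0 := by
  rw [Ring.lie_def]
  congr 1
  · split_ifs with h
    · subst h; simp
    · rw [single_mul_single_of_ne _ _ _ _ (Ne.symm h)]
  · split_ifs with h
    · subst h; simp
    · rw [single_mul_single_of_ne _ _ _ _ h]

theorem lie_tens (a b : Fin (3 + 2)) (p : Idx) :
    ⁅(single a b 1 : gl K 3 2), tens K p⁆ = vec K (unitAct a b p) := by
  rw [tens, TensorProduct.LieModule.lie_tmul_right, lie_single, lie_single, sub_tmul, tmul_sub]
  simp only [unitAct, vec_append]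
  rw [add_assoc, ← add_sub_assoc, sub_eq_add_neg, sub_eq_add_neg]
  simp only [← add_assoc]
  congr 1; congr 1; congr 1
  all_goals split_ifs <;> simp [tens, neg_one_smul' (K := K)]

theorem lie_vec (a b : Fin (3 + 2)) (l : Sparse) :
    ⁅(single a b 1 : gl K 3 2), vec K l⁆ = vec K (sparseAct a b l) := by
  induction l with
  | nil => simp [sparseAct]
  | cons t l ih =>
    rw [vec_cons, lie_add, lie_smul', lie_tens, ih]
    simp [sparseAct]

theorem form_tens_lie (a b : Fin (3 + 2)) (p : Idx) (x : Sq K) :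
    form K (tens K p) ⁅(single a b 1 : gl K 3 2), x⁆ =
      ev (fun q => form K (tens K q) x) (unitAct b a p) := by
  rw [form_comm, form_lie, form_comm, transpose_single, lie_tens, form_vec]

theorem par_add_par (i j : Fin (3 + 2)) :
    par 3 2 i + par 3 2 j = if odd i j then 1 else 0 := by
  revert i j; decide

theorem isHom_single {a b : Fin (3 + 2)} (h : odd a b = false) :
    IsHom K 0 (single a b 1 : gl K 3 2) := by
  intro i j hij
  rw [single_apply] at hij
  obtain ⟨rfl, rfl⟩ : a = i ∧ b = j := by by_contra h'; simp [h'] at hij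
  rw [par_add_par, h]; simp

theorem lsbr_eq_lie {C : gl K 3 2} (hC : IsHom K 0 C) (A : gl K 3 2) : lsbr K C A = ⁅C, A⁆ := by
  have hz : ∀ i j, par 3 2 i ≠ par 3 2 j → C i j = 0 := by
    intro i j h
    by_contra h'
    have := hC i j h'
    rw [CharTwo.add_eq_zero] at this
    exact h this
  have he : evenP K C = C := by
    ext i j; simp only [evenP, of_apply, ite_eq_left_iff]; exact fun h => (hz i j h).symm
  have ho : oddP K C = 0 := by
    ext i j; simp only [oddP, of_apply, Matrix.zero_apply, ite_eq_left_iff]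
    exact fun h => hz i j h
  have hA : evenPL K 3 2 A + oddPL K 3 2 A = A := by
    ext i j
    simp only [evenPL, oddPL, LinearMap.coe_mk, AddHom.coe_mk, evenP, oddP, Matrix.add_apply,
      of_apply]
    split_ifs <;> simp
  have h : A * C = evenPL K 3 2 A * C + oddPL K 3 2 A * C := by rw [← add_mul, hA]
  rw [Ring.lie_def, h]
  simp only [lsbr, he, ho, LinearMap.add_apply, LinearMap.sub_apply, LinearMap.comp_apply,
    LinearMap.mulLeft_apply, LinearMap.mulRight_apply, mul_zero, add_zero]
  abel

theorem actC_eq_lie {C : gl K 3 2} (hC : IsHom K 0 C) (x : Sq K) : actC K C x = ⁅C, x⁆ := by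
  induction x using TensorProduct.induction_on with
  | zero => simp
  | add x y hx hy => rw [map_add, lie_add, hx, hy]
  | tmul A D => simp [actC, lsbr_eq_lie hC, TensorProduct.LieModule.lie_tmul_right]

theorem isHom_sub {p : ZMod 2} {A D : gl K 3 2} (hA : IsHom K p A) (hD : IsHom K p D) :
    IsHom K p (A - D) := by
  intro i j h
  by_cases hA' : A i j = 0
  · exact hD i j fun h' => h (by simp [hA', h'])
  · exact hA i j hA'

theorem isHom_mul {p q : ZMod 2} {A D : gl K 3 2} (hA : IsHom K p A) (hD : IsHom K q D) :
    IsHom K (p + q) (A * D) := by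
  intro i j h
  rw [mul_apply] at h
  obtain ⟨k, -, hk⟩ := Finset.exists_ne_zero_of_sum_ne_zero h
  rw [← hA i k (left_ne_zero_of_mul hk), ← hD k j (right_ne_zero_of_mul hk)]
  linear_combination -CharTwo.add_self_eq_zero (par 3 2 k)

theorem isHom_lie {q : ZMod 2} {C A : gl K 3 2} (hC : IsHom K 0 C) (hA : IsHom K q A) :
    IsHom K q ⁅C, A⁆ := by
  rw [Ring.lie_def]
  have h1 := isHom_mul hC hA
  have h2 := isHom_mul hA hC
  rw [zero_add] at h1
  rw [add_zero] at h2
  exact isHom_sub h1 h2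

theorem lie_mem_sl {C : gl K 3 2} (hC : IsHom K 0 C) (A : gl K 3 2) : ⁅C, A⁆ ∈ sl K 3 2 := by
  change str K ⁅C, A⁆ = 0
  simp only [Ring.lie_def, str, Matrix.sub_apply, mul_sub, Finset.sum_sub_distrib, mul_apply,
    Finset.mul_sum]
  rw [Finset.sum_comm, sub_eq_zero]
  refine Finset.sum_congr rfl fun i _ => Finset.sum_congr rfl fun k _ => ?_
  by_cases h : C k i = 0
  · simp [h]
  · have := hC k i h
    rw [CharTwo.add_eq_zero] at this
    rw [this]; ring

theorem lie_mem_superExtSq {C : gl K 3 2} (hC : IsHom K 0 C) {x : Sq K}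
    (hx : x ∈ superExtSq K) : ⁅C, x⁆ ∈ superExtSq K := by
  induction hx using Submodule.span_induction with
  | zero => rw [lie_zero]; exact zero_mem _
  | add x y _ _ hx hy => rw [lie_add]; exact add_mem hx hy
  | smul c x _ hx => rw [lie_smul']; exact Submodule.smul_mem _ _ hx
  | mem t ht =>
    obtain ⟨q1, q2, x, y, hx, hy, rfl⟩ := ht
    have h1 : ⁅C, (x : gl K 3 2)⁆ ⊗ₜ[K] (y : gl K 3 2) -
        sg K (q1 * q2) • ((y : gl K 3 2) ⊗ₜ[K] ⁅C, (x : gl K 3 2)⁆) ∈ superExtSq K :=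
      Submodule.subset_span ⟨q1, q2, ⟨_, lie_mem_sl hC x⟩, y, isHom_lie hC hx, hy, rfl⟩
    have h2 : (x : gl K 3 2) ⊗ₜ[K] ⁅C, (y : gl K 3 2)⁆ -
        sg K (q1 * q2) • (⁅C, (y : gl K 3 2)⁆ ⊗ₜ[K] (x : gl K 3 2)) ∈ superExtSq K :=
      Submodule.subset_span ⟨q1, q2, x, ⟨_, lie_mem_sl hC y⟩, hx, isHom_lie hC hy, rfl⟩
    rw [lie_sub, lie_smul', TensorProduct.LieModule.lie_tmul_right,
      TensorProduct.LieModule.lie_tmul_right]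
    convert add_mem h1 h2 using 1
    rw [smul_add]; abel

theorem sg_ite (p q : Bool) :
    sg K ((if p then 1 else 0) * if q then 1 else 0) = (zsign (p && q) : K) := by
  cases p <;> cases q <;> simp [sg, zsign]

theorem sg_par (i : Fin (3 + 2)) : sg K (par 3 2 i) = (zsign (odd 0 i) : K) := by
  have : par 3 2 i = if odd 0 i then 1 else 0 := by revert i; decide
  rw [this]
  cases odd 0 i <;> simp [sg, zsign]

theorem zsign_mul_self (b : Bool) : (zsign b : K) * zsign b = 1 := by
  cases b <;> simp [zsign]

theorem ev_swapRow {x : Sq K} (hx : x ∈ superExtSq K) (p : Idx) :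
    ev (fun q => form K (tens K q) x) (swapRow p) = 0 := by
  rw [← form_vec]
  suffices h : superExtSq K ≤ LinearMap.ker (form K (vec K (swapRow p))) from h hx
  refine Submodule.span_le.mpr ?_
  rintro _ ⟨q1, q2, x, y, hx, hy, rfl⟩
  obtain ⟨i, j, k, l⟩ := p
  rw [SetLike.mem_coe, LinearMap.mem_ker, form_vec]
  simp only [ev, swapRow, List.map_cons, List.map_nil, List.sum_cons, List.sum_nil, map_sub,
    map_smul, form_tens_tmul, smul_eq_mul, Int.cast_one]
  have key : ∀ A D : gl K 3 2, ∀ p q, IsHom K p A → IsHom K q D → A i j * D k l ≠ 0 →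
      sg K (p * q) = (zsign (odd i j && odd k l) : K) := by
    intro A D p q hA hD h
    rw [← hA i j (left_ne_zero_of_mul h), ← hD k l (right_ne_zero_of_mul h), par_add_par,
      par_add_par, sg_ite]
  have hs := zsign_mul_self (K := K) (odd i j && odd k l)
  by_cases h1 : (x : gl K 3 2) i j * (y : gl K 3 2) k l = 0
  · by_cases h2 : (y : gl K 3 2) i j * (x : gl K 3 2) k l = 0
    · linear_combination (1 - zsign (odd i j && odd k l) * sg K (q1 * q2)) * h1 +
        (zsign (odd i j && odd k l) - sg K (q1 * q2)) * h2
    · have := key _ _ _ _ hy hx h2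
      rw [mul_comm] at this
      rw [this]
      linear_combination (1 - (zsign (odd i j && odd k l) : K) ^ 2) * h1
  · rw [key _ _ _ _ hx hy h1]
    linear_combination -(x : gl K 3 2) i j * (y : gl K 3 2) k l * hs

theorem ev_strRow {x : Sq K} (hx : x ∈ superExtSq K) (k l : Fin (3 + 2)) :
    ev (fun q => form K (tens K q) x) (strRow k l) = 0 := by
  rw [← form_vec]
  suffices h : superExtSq K ≤ LinearMap.ker (form K (vec K (strRow k l))) from h hx
  refine Submodule.span_le.mpr ?_
  rintro _ ⟨q1, q2, x, y, hx, hy, rfl⟩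
  have key : ∀ A ∈ sl K 3 2, ∀ D : gl K 3 2, form K (vec K (strRow k l)) (A ⊗ₜ D) = 0 := by
    intro A hA D
    have hA' : str K A = 0 := hA
    rw [form_vec, ev, strRow, List.map_map, ← List.ofFn_eq_map, List.sum_ofFn]
    simp only [Function.comp_apply, form_tens_tmul, ← sg_par, ← mul_assoc]
    rw [← Finset.sum_mul, ← str, hA', zero_mul]
  rw [SetLike.mem_coe, LinearMap.mem_ker, map_sub, map_smul, key _ x.2, key _ y.2]
  simp

/-- The matrix with the given list of entries. -/
def mat (K : Type) [Field K] (X : SparseMat) : gl K 3 2 :=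
  (X.map fun t => (t.2 : K) • (single t.1.1 t.1.2 1 : gl K 3 2)).sum

theorem mat_cons (t : (Fin (3 + 2) × Fin (3 + 2)) × ℤ) (X : SparseMat) :
    mat K (t :: X) = (t.2 : K) • (single t.1.1 t.1.2 1 : gl K 3 2) + mat K X := rfl

theorem mat_mem_sl {X : SparseMat} (h : strL X = 0) : mat K X ∈ sl K 3 2 := by
  change str K (mat K X) = 0
  rw [← Int.cast_zero (R := K), ← h]
  clear h
  induction X with
  | nil => simp [mat, strL, str]
  | cons t X ih =>
    have h1 : str K (mat K (t :: X)) = t.2 * str K (single t.1.1 t.1.2 1 : gl K 3 2) +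
        str K (mat K X) := by
      simp only [mat_cons, str, Matrix.add_apply, Matrix.smul_apply, mul_add,
        Finset.sum_add_distrib, Finset.mul_sum, smul_eq_mul]
      congr 1
      exact Finset.sum_congr rfl fun i _ => by ring
    rw [h1, ih, strL, strL, List.map_cons, List.sum_cons, Int.cast_add]
    congr 1
    simp only [str, single_apply, sg_par]
    rw [Finset.sum_eq_single t.1.1]
    · by_cases h : t.1.1 = t.1.2 <;> simp [h, Ne.symm, mul_comm]
    · intro i _ hi; simp [hi.symm]
    · simp

theorem isHom_mat {X : SparseMat} {p : Bool} (h : homL p X = true) :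
    IsHom K (if p then 1 else 0) (mat K X) := by
  induction X with
  | nil => intro i j h'; simp [mat] at h'
  | cons t X ih =>
    simp only [homL, List.all_cons, Bool.and_eq_true, beq_iff_eq] at h
    intro i j hij
    by_cases hX : mat K X i j = 0
    · have : (single t.1.1 t.1.2 1 : gl K 3 2) i j ≠ 0 := by
        intro h0
        apply hij
        rw [mat_cons, Matrix.add_apply, Matrix.smul_apply, h0, smul_zero, zero_add]
        exact hX
      rw [single_apply] at this
      obtain ⟨h1, h2⟩ : t.1.1 = i ∧ t.1.2 = j := by by_contra h'; simp [h'] at this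
      rw [par_add_par, ← h1, ← h2, h.1]
    · exact ih h.2 i j hX

theorem vec_outer (X Y : SparseMat) : vec K (outer X Y) = mat K X ⊗ₜ[K] mat K Y := by
  have h1 : ∀ t : (Fin (3 + 2) × Fin (3 + 2)) × ℤ, vec K (Y.map fun y =>
      ((t.1.1, t.1.2, y.1.1, y.1.2), t.2 * y.2)) =
      ((t.2 : K) • (single t.1.1 t.1.2 1 : gl K 3 2)) ⊗ₜ[K] mat K Y := by
    intro t
    induction Y with
    | nil => simp [mat]
    | cons y Y ih =>
      rw [List.map_cons, vec_cons, ih, mat_cons, tmul_add]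
      congr 1
      rw [smul_tmul_smul, tens, Int.cast_mul]
  induction X with
  | nil => simp [mat, outer]
  | cons x X ih =>
    rw [outer, List.flatMap_cons, vec_append, ← outer, ih, h1, mat_cons, add_tmul]

theorem vec_gen_mem {g : Gen} (hg : g.valid = true) : vec K g.sparse ∈ superExtSq K := by
  simp only [Gen.valid, Bool.and_eq_true, beq_iff_eq] at hg
  refine Submodule.subset_span ⟨_, _, ⟨_, mat_mem_sl hg.1.1.1⟩, ⟨_, mat_mem_sl hg.1.1.2⟩,
    isHom_mat hg.1.2, isHom_mat hg.2, ?_⟩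
  rw [Gen.sparse, vec_append, vec_scale, vec_outer, vec_outer, sg_ite, Int.cast_neg, sub_eq_add_neg]
  congr 1
  exact neg_smul (zsign _ : K) (_ : Sq K)

theorem highest_valid : ∀ i, (highest i).all Gen.valid := by decide +kernel

theorem vec_hw_mem (i : Fin 27) : vec K (hw i) ∈ superExtSq K := by
  have h := List.all_eq_true.mp (highest_valid i)
  rw [hw]
  revert h
  induction highest i with
  | nil => simp
  | cons g l ih =>
    intro h
    rw [List.flatMap_cons, vec_append]
    exact add_mem (vec_gen_mem (h g (by simp))) (ih fun x hx => h x (by simp [hx]))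

/-- A vector annihilated by the even raising operators. -/
def IsSingular (x : Sq K) : Prop :=
  ∀ a b, a < b → odd a b = false → ⁅(single a b 1 : gl K 3 2), x⁆ = 0

/-- Stability under the even raising operators. -/
def RaiseStable (S : Submodule K (Sq K)) : Prop :=
  ∀ a b, a < b → odd a b = false → ∀ t ∈ S, ⁅(single a b 1 : gl K 3 2), t⁆ ∈ S

/-- Stability under the even lowering operators. -/
def LowerStable (S : Submodule K (Sq K)) : Prop :=
  ∀ a b, b < a → odd a b = false → ∀ t ∈ S, ⁅(single a b 1 : gl K 3 2), t⁆ ∈ S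

/-- The smallest subspace containing `v` that is stable under the even lowering operators. -/
def loweringSpan (v : Sq K) : Submodule K (Sq K) := sInf {S | v ∈ S ∧ LowerStable S}

theorem mem_loweringSpan (v : Sq K) : v ∈ loweringSpan v :=
  Submodule.mem_sInf.mpr fun _ hS => hS.1

theorem lowerStable_loweringSpan (v : Sq K) : LowerStable (loweringSpan v) :=
  fun a b hab ho t ht => Submodule.mem_sInf.mpr fun S hS =>
    hS.2 a b hab ho t (Submodule.mem_sInf.mp ht S hS)

theorem loweringSpan_le {v : Sq K} {S : Submodule K (Sq K)} (hv : v ∈ S) (hS : LowerStable S) :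
    loweringSpan v ≤ S := sInf_le ⟨hv, hS⟩

theorem odd_comm (a b : Fin (3 + 2)) : odd a b = odd b a := by
  revert a b; decide

theorem smul_lie' (c : K) (C : gl K 3 2) (x : Sq K) : ⁅c • C, x⁆ = c • ⁅C, x⁆ := smul_lie c C x

theorem lie_mem_of_single {S : Submodule K (Sq K)} {x : Sq K} {C : gl K 3 2} (hC : IsHom K 0 C)
    (h : ∀ a b, odd a b = false → ⁅(single a b 1 : gl K 3 2), x⁆ ∈ S) : ⁅C, x⁆ ∈ S := by
  rw [matrix_eq_sum_single C, sum_lie]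
  refine Submodule.sum_mem _ fun a _ => ?_
  rw [sum_lie]
  refine Submodule.sum_mem _ fun b _ => ?_
  by_cases hab : C a b = 0
  · simp [hab]
  · have := hC a b hab
    rw [par_add_par] at this
    rw [show single a b (C a b) = C a b • (single a b 1 : gl K 3 2) by simp, smul_lie']
    exact S.smul_mem _ (h a b (by by_contra h'; simp [h'] at this))

theorem lie_mem_loweringSpan {v : Sq K} (hv : ∀ C : gl K 3 2, IsHom K 0 C → ⁅C, v⁆ ∈ loweringSpan v)
    {C : gl K 3 2} (hC : IsHom K 0 C) {t : Sq K} (ht : t ∈ loweringSpan v) :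
    ⁅C, t⁆ ∈ loweringSpan v := by
  let S : Submodule K (Sq K) :=
    { carrier := {t | t ∈ loweringSpan v ∧ ∀ C : gl K 3 2, IsHom K 0 C → ⁅C, t⁆ ∈ loweringSpan v}
      zero_mem' := ⟨zero_mem _, fun C _ => by rw [lie_zero]; exact zero_mem _⟩
      add_mem' := fun hx hy => ⟨add_mem hx.1 hy.1, fun C hC => by
        rw [lie_add]; exact add_mem (hx.2 C hC) (hy.2 C hC)⟩
      smul_mem' := fun c x hx => ⟨Submodule.smul_mem _ _ hx.1, fun C hC => by
        rw [lie_smul']; exact Submodule.smul_mem _ _ (hx.2 C hC)⟩ }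
  have hS : loweringSpan v ≤ S := by
    refine loweringSpan_le ⟨mem_loweringSpan v, hv⟩ fun a b hab ho t ht => ?_
    have hlow := lowerStable_loweringSpan v a b hab ho
    refine ⟨hlow t ht.1, fun C hC => ?_⟩
    rw [leibniz_lie]
    exact add_mem (ht.2 _ (isHom_lie hC (isHom_single ho))) (hlow _ (ht.2 C hC))
  exact (hS ht).2 C hC

/-- The orthogonal complement of a vector. -/
noncomputable def orth (y : Sq K) : Submodule K (Sq K) := LinearMap.ker (form K y)

theorem mem_orth {y t : Sq K} : t ∈ orth y ↔ form K t y = 0 := by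
  rw [orth, LinearMap.mem_ker, form_comm]

theorem form_eq_zero_of_mem_loweringSpan {v y t : Sq K} (hy : IsSingular y)
    (hv : form K v y = 0) (ht : t ∈ loweringSpan v) : form K t y = 0 := by
  suffices h : loweringSpan v ≤ orth y from mem_orth.mp (h ht)
  refine loweringSpan_le (mem_orth.mpr hv) fun a b hab ho t _ => ?_
  rw [mem_orth, form_lie, transpose_single, hy b a hab (by rw [odd_comm, ho]), map_zero]

theorem eq_zero_of_isSingular [CharZero K] {x : Sq K} (hx : x ∈ superExtSq K) (hs : IsSingular x)
    (h : ∀ i, form K (vec K (hw i)) x = 0) : x = 0 := by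
  refine eq_zero_of_form_tens x (eq_zero_of_rows _ (ev_swapRow hx) (ev_strRow hx) ?_ ?_)
  · intro a b p hab ho
    rw [← form_tens_lie, hs a b hab ho, map_zero]
  · intro i
    rw [← form_vec, h i]

/-- The height of a basis tensor, which the raising operators decrease coordinatewise. -/
def height (p : Idx) : ℕ := p.1 + (4 - p.2.1) + p.2.2.1 + (4 - p.2.2.2)

theorem height_lt {a b : Fin (3 + 2)} (hab : a < b) {p : Idx} {t : Idx × ℤ}
    (ht : t ∈ unitAct b a p) : height p < height t.1 := by
  obtain ⟨i, j, k, l⟩ := p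
  simp only [unitAct, List.mem_append] at ht
  have hb := b.isLt
  have hi := i.isLt
  have hj := j.isLt
  have hk := k.isLt
  have hl := l.isLt
  rcases ht with ((ht | ht) | ht) | ht
  all_goals
    split_ifs at ht with h
    · simp only [List.mem_singleton] at ht
      subst ht
      subst h
      simp only [height]
      omega
    · simp at ht

theorem exists_isSingular_aux {W : Submodule K (Sq K)} (hW : RaiseStable W) (n : ℕ) :
    ∀ w ∈ W, w ≠ 0 → (∀ p, form K (tens K p) w ≠ 0 → height p < n) →
      ∃ s ∈ W, s ≠ 0 ∧ IsSingular s := by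
  induction n with
  | zero =>
    intro w _ h0 h
    exact absurd (eq_zero_of_form_tens w fun p => by by_contra h'; simpa using h p h') h0
  | succ n ih =>
    intro w hw h0 h
    by_cases hs : IsSingular w
    · exact ⟨w, hw, h0, hs⟩
    · simp only [IsSingular, not_forall] at hs
      obtain ⟨a, b, hab, ho, hne⟩ := hs
      refine ih _ (hW a b hab ho w hw) hne fun p hp => ?_
      rw [form_tens_lie, ev] at hp
      obtain ⟨x, hx, hx0⟩ : ∃ x ∈ (unitAct b a p).map
          (fun t => (t.2 : K) * form K (tens K t.1) w), x ≠ 0 := by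
        by_contra! h'
        exact hp (List.sum_eq_zero h')
      obtain ⟨t, ht, rfl⟩ := List.mem_map.mp hx
      have h1 := h t.1 (right_ne_zero_of_mul hx0)
      have h2 := height_lt hab ht
      omega

theorem exists_isSingular {W : Submodule K (Sq K)} (hW : RaiseStable W) (h : W ≠ ⊥) :
    ∃ s ∈ W, s ≠ 0 ∧ IsSingular s := by
  obtain ⟨w, hw, h0⟩ := Submodule.exists_mem_ne_zero_of_ne_bot h
  refine exists_isSingular_aux hW 17 w hw h0 fun p _ => ?_
  simp only [height]
  omega

theorem eq_bot_of_raiseStable {W : Submodule K (Sq K)} (hW : RaiseStable W)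
    (h : ∀ s ∈ W, IsSingular s → s = 0) : W = ⊥ := by
  by_contra h'
  obtain ⟨s, hs, h0, hsing⟩ := exists_isSingular hW h'
  exact h0 (h s hs hsing)

theorem isZero_raise_hw : ∀ i a b, a < b → odd a b = false →
    isZero (sparseAct a b (hw i)) = true := by decide +kernel

theorem isZero_torus_hw : ∀ i a,
    isZero (sparseAct a a (hw i) ++ scale (-wtL (hw i) a) (hw i)) = true := by decide +kernel

theorem dot_hw : ∀ i j, dot (hw i) (hw j) = 0 ↔ i ≠ j := by decide +kernel

theorem isSingular_hw (i : Fin 27) : IsSingular (vec K (hw i)) := fun a b hab ho => by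
  rw [lie_vec, vec_eq_zero _ (isZero_raise_hw i a b hab ho)]

theorem lie_single_self_hw (i : Fin 27) (a : Fin (3 + 2)) :
    ⁅(single a a 1 : gl K 3 2), vec K (hw i)⁆ = (wtL (hw i) a : K) • vec K (hw i) := by
  have h := vec_eq_zero (K := K) _ (isZero_torus_hw i a)
  rw [vec_append, vec_scale, ← lie_vec, Int.cast_neg] at h
  rw [eq_neg_of_add_eq_zero_left h]
  exact neg_eq_iff_eq_neg.mpr (neg_smul (_ : K) (_ : Sq K))

theorem form_hw_ne [CharZero K] {i j : Fin 27} (h : i ≠ j) :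
    form K (vec K (hw i)) (vec K (hw j)) = 0 := by
  rw [form_vec_vec, (dot_hw i j).mpr h, Int.cast_zero]

theorem form_hw_self [CharZero K] (i : Fin 27) :
    form K (vec K (hw i)) (vec K (hw i)) ≠ 0 := by
  rw [form_vec_vec, Int.cast_ne_zero]
  exact fun h => (dot_hw i i).mp h rfl

variable (K) in
/-- The irreducible submodule generated by the `i`-th highest weight vector. -/
noncomputable def component (i : Fin 27) : Submodule K (Sq K) := loweringSpan (vec K (hw i))

theorem lie_mem_component {C : gl K 3 2} (hC : IsHom K 0 C) {i : Fin 27} {t : Sq K}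
    (ht : t ∈ component K i) : ⁅C, t⁆ ∈ component K i := by
  refine lie_mem_loweringSpan (fun C hC => lie_mem_of_single hC fun a b ho => ?_) hC ht
  rcases lt_trichotomy a b with h | rfl | h
  · rw [isSingular_hw i a b h ho]; exact zero_mem _
  · rw [lie_single_self_hw]; exact Submodule.smul_mem _ _ (mem_loweringSpan _)
  · exact lowerStable_loweringSpan _ a b h ho _ (mem_loweringSpan _)

theorem raiseStable_of_lie {S : Submodule K (Sq K)}
    (h : ∀ C : gl K 3 2, IsHom K 0 C → ∀ t ∈ S, ⁅C, t⁆ ∈ S) : RaiseStable S :=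
  fun _ _ _ ho t ht => h _ (isHom_single ho) t ht

theorem component_le (i : Fin 27) : component K i ≤ superExtSq K :=
  loweringSpan_le (vec_hw_mem i) fun _ _ _ ho _ ht => lie_mem_superExtSq (isHom_single ho) ht

theorem form_component_hw [CharZero K] {i j : Fin 27} (h : i ≠ j) {t : Sq K}
    (ht : t ∈ component K i) : form K t (vec K (hw j)) = 0 :=
  form_eq_zero_of_mem_loweringSpan (isSingular_hw j) (form_hw_ne h) ht

theorem exists_eq_smul_hw [CharZero K] {i : Fin 27} {s : Sq K} (hs : s ∈ component K i)
    (hsing : IsSingular s) : ∃ c : K, s = c • vec K (hw i) := by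
  set v := vec K (hw i) with hv
  refine ⟨form K v s / form K v v, ?_⟩
  rw [← sub_eq_zero]
  refine eq_zero_of_isSingular
    (sub_mem (component_le i hs) (Submodule.smul_mem _ _ (vec_hw_mem i))) ?_ fun j => ?_
  · intro a b hab ho
    rw [lie_sub, lie_smul', hsing a b hab ho, isSingular_hw i a b hab ho, smul_zero, sub_zero]
  · rw [map_sub, map_smul, smul_eq_mul]
    by_cases hij : i = j
    · subst hij
      rw [div_mul_cancel₀ _ (form_hw_self i), sub_self]
    · rw [form_hw_ne (Ne.symm hij), form_comm, form_component_hw hij hs, mul_zero, sub_zero]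

theorem component_ne_bot [CharZero K] (i : Fin 27) : component K i ≠ ⊥ := fun h => by
  have h0 : vec K (hw i) = 0 := (Submodule.eq_bot_iff _).mp h _ (mem_loweringSpan _)
  exact form_hw_self (K := K) i (by rw [h0, map_zero])

theorem single_mem_sl {a b : Fin (3 + 2)} (h : a ≠ b) : (single a b 1 : gl K 3 2) ∈ sl K 3 2 := by
  change str K _ = 0
  refine Finset.sum_eq_zero fun i _ => ?_
  rw [single_apply, if_neg (by rintro ⟨rfl, rfl⟩; exact h rfl), mul_zero]

theorem component_irreducible [CharZero K] {i : Fin 27} {W : Submodule K (Sq K)}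
    (hW : W ≤ component K i)
    (h : ∀ C ∈ sl K 3 2, IsHom K 0 C → ∀ t ∈ W, ⁅C, t⁆ ∈ W) : W = ⊥ ∨ W = component K i := by
  by_cases hb : W = ⊥
  · exact Or.inl hb
  obtain ⟨s, hs, h0, hsing⟩ := exists_isSingular
    (fun a b hab ho t ht => h _ (single_mem_sl hab.ne) (isHom_single ho) t ht) hb
  obtain ⟨c, rfl⟩ := exists_eq_smul_hw (hW hs) hsing
  have hc : c ≠ 0 := by rintro rfl; exact h0 (zero_smul K (_ : Sq K))
  refine Or.inr (le_antisymm hW (loweringSpan_le ((W.smul_mem_iff hc).mp hs) ?_))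
  exact fun a b hab ho t ht => h _ (single_mem_sl hab.ne') (isHom_single ho) t ht

theorem lie_mem_iSup {ι : Sort*} {S : ι → Submodule K (Sq K)} {C : gl K 3 2}
    (h : ∀ i, ∀ t ∈ S i, ⁅C, t⁆ ∈ S i) {t : Sq K} (ht : t ∈ ⨆ i, S i) : ⁅C, t⁆ ∈ ⨆ i, S i := by
  induction ht using Submodule.iSup_induction' with
  | mem i x hx => exact Submodule.mem_iSup_of_mem i (h i x hx)
  | zero => rw [lie_zero]; exact zero_mem _
  | add x y _ _ hx hy => rw [lie_add]; exact add_mem hx hy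

theorem iSupIndep_component [CharZero K] : iSupIndep (component K) := by
  intro i
  rw [disjoint_iff]
  refine eq_bot_of_raiseStable (raiseStable_of_lie fun C hC t ht => ⟨lie_mem_component hC ht.1,
    lie_mem_iSup (fun j _ ht => lie_mem_iSup (fun _ _ ht => lie_mem_component hC ht) ht)
      ht.2⟩) fun s hs hsing => ?_
  obtain ⟨c, rfl⟩ := exists_eq_smul_hw hs.1 hsing
  have hle : ⨆ j, ⨆ _ : j ≠ i, component K j ≤ orth (vec K (hw i)) :=
    iSup₂_le fun j hj t ht => mem_orth.mpr (form_component_hw hj ht)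
  have h := mem_orth.mp (hle hs.2)
  rw [map_smul, LinearMap.smul_apply, smul_eq_mul] at h
  rw [(mul_eq_zero.mp h).resolve_right (form_hw_self i)]
  exact zero_smul K (_ : Sq K)

theorem iSup_component [CharZero K] : ⨆ i, component K i = superExtSq K := by
  have hle : ⨆ i, component K i ≤ superExtSq K := iSup_le component_le
  set S := ⨆ i, component K i with hS
  let f : superExtSq K →ₗ[K] Module.Dual K S :=
    (LinearMap.lcomp K K S.subtype) ∘ₗ (form K).flip ∘ₗ (superExtSq K).subtype
  have hf : ∀ x s, f x s = form K (s : Sq K) (x : Sq K) := fun _ _ => rfl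
  let R : Submodule K (Sq K) := superExtSq K ⊓ ⨅ s ∈ S, orth s
  have hR : ∀ x, x ∈ R ↔ x ∈ superExtSq K ∧ ∀ s ∈ S, form K s x = 0 := by
    intro x
    simp only [R, Submodule.mem_inf, Submodule.mem_iInf, mem_orth, form_comm x]
  have hbot : R = ⊥ := by
    refine eq_bot_of_raiseStable (fun a b hab ho t ht => ?_) fun s hs hsing => ?_
    · rw [hR] at ht ⊢
      refine ⟨lie_mem_superExtSq (isHom_single ho) ht.1, fun s hs => ?_⟩
      rw [form_comm, form_lie, form_comm, transpose_single]
      exact ht.2 _ (lie_mem_iSup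
        (fun i _ h => lie_mem_component (isHom_single (by rw [odd_comm, ho])) h) hs)
    · rw [hR] at hs
      exact eq_zero_of_isSingular hs.1 hsing fun i =>
        hs.2 _ (Submodule.mem_iSup_of_mem i (mem_loweringSpan _))
  have hinj : Function.Injective f := by
    intro x y hxy
    refine Subtype.ext (sub_eq_zero.mp ((Submodule.eq_bot_iff R).mp hbot _
      ((hR _).mpr ⟨sub_mem x.2 y.2, fun s hs => ?_⟩)))
    have h := LinearMap.congr_fun hxy ⟨s, hs⟩
    rw [hf, hf] at h
    rw [map_sub, h, sub_self]
  refine Submodule.eq_of_le_of_finrank_le hle ?_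
  rw [← Subspace.dual_finrank_eq (K := K) (V := S)]
  exact LinearMap.finrank_le_finrank_of_injective hinj

end Algebra

end SuperExt

/-- Let `L = sl(3|2)` with even part `L₀`.  The super-exterior square
`Λε²L = ⋀²(L₀̄) ⊕ (L₀̄ ⊗ L₁̄) ⊕ Sym²(L₁̄)` is the direct sum of `27` irreducible
`L₀`-submodules. -/
theorem superexterior_square_sl_3_2_decomposes_into_27_irreducibles
    (K : Type) [Field K] [IsAlgClosed K] [CharZero K] :
    ∃ U : Fin 27 → Submodule K (TensorProduct K (gl K 3 2) (gl K 3 2)),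
      -- the `U i` are submodules of `Λε²L`, stable under the action of `L₀` ...
      (∀ i, U i ≤ superExtSq K) ∧
      (∀ i, ∀ C ∈ sl K 3 2, IsHom K 0 C → ∀ t ∈ U i, actC K C t ∈ U i) ∧
      -- ... irreducible ...
      (∀ i, U i ≠ ⊥) ∧
      (∀ i, ∀ W : Submodule K (TensorProduct K (gl K 3 2) (gl K 3 2)), W ≤ U i →
        (∀ C ∈ sl K 3 2, IsHom K 0 C → ∀ t ∈ W, actC K C t ∈ W) → W = ⊥ ∨ W = U i) ∧
      -- ... and `Λε²L` is their (internal) direct sum.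
      iSupIndep U ∧ (⨆ i, U i) = superExtSq K := by
  let : LieRing (gl K 3 2) := LieRing.ofAssociativeRing
  refine ⟨SuperExt.component K, SuperExt.component_le, fun i C _ hC t ht => ?_,
    SuperExt.component_ne_bot, fun i W hW h => SuperExt.component_irreducible hW ?_,
    SuperExt.iSupIndep_component, SuperExt.iSup_component⟩
  · rw [SuperExt.actC_eq_lie hC]
    exact SuperExt.lie_mem_component hC ht
  · intro C hC hC0 t ht
    rw [← SuperExt.actC_eq_lie hC0]
    exact h C hC hC0 t ht
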